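/- Let Σ be a symmetric positive definite k×k real matrix, Σ̂ a symmetric k×k real matrix, and let Λ be a nonempty subset of ℝ^k. Let λ̂ ∈ Λ satisfy λ̂ᵀΣ̂λ̂ ≤ λᵀΣ̂λ for all λ ∈ Λ, and let λ* ∈ Λ be arbitrary. Then, with ε = ‖I − Σ̂Σ⁻¹‖_op, one has (1 − ε) · λ̂ᵀΣλ̂ ≤ (1 + ε) · λ*ᵀΣλ*. In particular, taking Λ = {λ : λᵀ1 = 1} and λ* the minimizer of λᵀΣλ over Λ, this is the oracle inequality (1 − ‖I − Σ̂Σ⁻¹‖_op) ISE(f̂_AV) ≤ (1 + ‖I − Σ̂Σ⁻¹‖_op) ISE(f̂*), and the same inequality holds for any constrained subset Λ of the hyperplane, such as the simplex used in convex averaging. -/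

import Mathlib

open Matrix

/-- The operator norm of a `k × k` real matrix, induced by the Euclidean norm
on `ℝ^k`: `‖M‖_op = sup_{‖x‖ = 1} ‖M x‖`. -/
noncomputable def opNorm {k : ℕ} (M : Matrix (Fin k) (Fin k) ℝ) : ℝ :=
  ‖LinearMap.toContinuousLinearMap (Matrix.toEuclideanLin M)‖

lemma opNorm_neg {k : ℕ} (M : Matrix (Fin k) (Fin k) ℝ) : opNorm (-M) = opNorm M := by
  simp [opNorm]

lemma norm_mulVec_le_opNorm {k : ℕ} (M : Matrix (Fin k) (Fin k) ℝ) (x : Fin k → ℝ) :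
    ‖WithLp.toLp 2 (M *ᵥ x)‖ ≤ opNorm M * ‖WithLp.toLp 2 x‖ :=
  (LinearMap.toContinuousLinearMap (Matrix.toEuclideanLin M)).le_opNorm (WithLp.toLp 2 x)

/-- Every real eigenvalue is bounded in absolute value by the operator norm. -/
lemma abs_le_opNorm_of_mulVec_eq_smul {k : ℕ} {M : Matrix (Fin k) (Fin k) ℝ} {c : ℝ}
    {x : Fin k → ℝ} (hx : x ≠ 0) (h : M *ᵥ x = c • x) : |c| ≤ opNorm M := by
  have hle := norm_mulVec_le_opNorm M x
  rw [h, WithLp.toLp_smul, norm_smul, Real.norm_eq_abs] at hle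
  exact le_of_mul_le_mul_right hle (norm_pos_iff.mpr (by simpa using hx))

open scoped MatrixOrder in
lemma Matrix.PosDef.exists_isUnit_conjTranspose_mul_self {k : ℕ}
    {S : Matrix (Fin k) (Fin k) ℝ} (hS : S.PosDef) :
    ∃ B : Matrix (Fin k) (Fin k) ℝ, IsUnit B ∧ S = Bᴴ * B := by
  obtain ⟨B, hB⟩ := CStarAlgebra.nonneg_iff_eq_star_mul_self.mp hS.posSemidef.nonneg
  refine ⟨B, ?_, hB⟩
  have hu := (Matrix.isUnit_iff_isUnit_det _).mp hS.isUnit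
  rw [hB, det_mul] at hu
  exact (Matrix.isUnit_iff_isUnit_det _).mpr (isUnit_of_mul_isUnit_right hu)

/-- If `S` is positive definite and `E * S` is symmetric, then `E * S ≤ ‖E‖_op • S` in the
Loewner order. -/
lemma posSemidef_opNorm_smul_sub_mul {k : ℕ} {S E : Matrix (Fin k) (Fin k) ℝ}
    (hS : S.PosDef) (hE : (E * S).IsHermitian) : (opNorm E • S - E * S).PosSemidef := by
  obtain ⟨B, hB, rfl⟩ := hS.exists_isUnit_conjTranspose_mul_self
  have hBdet := (Matrix.isUnit_iff_isUnit_det _).mp hB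
  have hBHdet : IsUnit Bᴴ.det := by simpa [det_conjTranspose] using hBdet
  set D := opNorm E • (Bᴴ * B) - E * (Bᴴ * B) with hD
  have hDherm : D.IsHermitian :=
    ((isHermitian_conjTranspose_mul_self B).smul (IsSelfAdjoint.all _)).sub hE
  have hN : ((B⁻¹)ᴴ * D * B⁻¹).IsHermitian := isHermitian_conjTranspose_mul_mul _ hDherm
  have hBN : Bᴴ * ((B⁻¹)ᴴ * D * B⁻¹) = opNorm E • Bᴴ - E * Bᴴ := by
    rw [conjTranspose_nonsing_inv, ← mul_assoc, ← mul_assoc, mul_nonsing_inv _ hBHdet, one_mul,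
      hD, sub_mul, smul_mul_assoc, ← mul_assoc E, mul_nonsing_inv_cancel_right _ _ hBdet,
      mul_nonsing_inv_cancel_right _ _ hBdet]
  have hpos : ((B⁻¹)ᴴ * D * B⁻¹).PosSemidef := by
    rw [hN.posSemidef_iff_eigenvalues_nonneg]
    intro i
    set v : Fin k → ℝ := ⇑(hN.eigenvectorBasis i) with hv
    have hv0 : v ≠ 0 := by
      simpa [hv] using hN.eigenvectorBasis.orthonormal.ne_zero i
    have hw0 : Bᴴ *ᵥ v ≠ 0 := fun h => hv0 <|
      mulVec_injective_of_isUnit ((Matrix.isUnit_iff_isUnit_det _).mpr hBHdet)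
        (h.trans (mulVec_zero _).symm)
    have heig := congrArg (Bᴴ *ᵥ ·) (hN.mulVec_eigenvectorBasis i)
    simp only [← hv, mulVec_mulVec, hBN, sub_mulVec, mulVec_smul, smul_mulVec] at heig
    rw [← mulVec_mulVec] at heig
    have hE' : E *ᵥ (Bᴴ *ᵥ v) = (opNorm E - hN.eigenvalues i) • (Bᴴ *ᵥ v) := by
      rw [sub_smul, ← heig, sub_sub_cancel]
    simpa using (le_abs_self _).trans (abs_le_opNorm_of_mulVec_eq_smul hw0 hE')
  have h := hpos.conjTranspose_mul_mul_same B
  rwa [hBN, sub_mul, smul_mul_assoc, mul_assoc E] at h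

/-- The quadratic forms of `S` and `T` differ by at most `‖1 - T * S⁻¹‖_op` times that of `S`. -/
lemma abs_dotProduct_sub_le_opNorm_mul {k : ℕ} {S T : Matrix (Fin k) (Fin k) ℝ}
    (hS : S.PosDef) (hT : T.IsSymm) (x : Fin k → ℝ) :
    |x ⬝ᵥ (S *ᵥ x) - x ⬝ᵥ (T *ᵥ x)| ≤ opNorm (1 - T * S⁻¹) * (x ⬝ᵥ (S *ᵥ x)) := by
  have hmul : (1 - T * S⁻¹) * S = S - T := by
    rw [sub_mul, one_mul,
      nonsing_inv_mul_cancel_right _ _ ((Matrix.isUnit_iff_isUnit_det _).mp hS.isUnit)]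
  have hherm : (S - T).IsHermitian :=
    hS.isHermitian.sub (by rwa [IsHermitian, conjTranspose_eq_transpose_of_trivial])
  have h₁ := (posSemidef_opNorm_smul_sub_mul (E := 1 - T * S⁻¹) hS
    (by rwa [hmul])).dotProduct_mulVec_nonneg x
  have h₂ := (posSemidef_opNorm_smul_sub_mul (E := -(1 - T * S⁻¹)) hS
    (by rw [neg_mul, hmul]; exact hherm.neg)).dotProduct_mulVec_nonneg x
  rw [opNorm_neg, neg_mul] at h₂
  simp only [hmul, star_trivial, sub_mulVec, neg_mulVec, smul_mulVec, dotProduct_sub,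
    dotProduct_neg, dotProduct_smul, smul_eq_mul] at h₁ h₂
  rw [abs_le]
  constructor <;> linarith

/-- The oracle inequality: if `λ̂ ∈ Λ` minimizes the quadratic form `λᵀ Σ̂ λ`
over a nonempty set `Λ` and `λ* ∈ Λ` is arbitrary, then with
`ε = ‖I - Σ̂ Σ⁻¹‖_op` one has `(1 - ε) λ̂ᵀ Σ λ̂ ≤ (1 + ε) λ*ᵀ Σ λ*`. -/
theorem oracle_inequality (k : ℕ)
    (S : Matrix (Fin k) (Fin k) ℝ) (hS : S.PosDef)
    (Shat : Matrix (Fin k) (Fin k) ℝ) (hShat : Shat.IsSymm)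
    (Λ : Set (Fin k → ℝ)) (hΛ : Λ.Nonempty)
    (lamhat : Fin k → ℝ) (hlamhat : lamhat ∈ Λ)
    (hmin : ∀ lam ∈ Λ, lamhat ⬝ᵥ (Shat *ᵥ lamhat) ≤ lam ⬝ᵥ (Shat *ᵥ lam))
    (lamstar : Fin k → ℝ) (hlamstar : lamstar ∈ Λ) :
    (1 - opNorm (1 - Shat * S⁻¹)) * (lamhat ⬝ᵥ (S *ᵥ lamhat)) ≤
      (1 + opNorm (1 - Shat * S⁻¹)) * (lamstar ⬝ᵥ (S *ᵥ lamstar)) := by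
  have hhat := le_of_abs_le (abs_dotProduct_sub_le_opNorm_mul hS hShat lamhat)
  have hstar := neg_le_of_abs_le (abs_dotProduct_sub_le_opNorm_mul hS hShat lamstar)
  linarith [hmin lamstar hlamstar]
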